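/- arXiv:math/9612208 — 3 statements merged into one kernel-verified Lean document; each statement's English description precedes it below -/
import Mathlib

section
/- Let T be a tree of finite sequences of ordinals below ω₂ containing no perfect subtree. Then for every t ∈ T, the set {s ∈ T : t ⊆ s and h_T(s) = h_T(t)} of extensions of t of the same rank has cardinality at most ℵ₁. -/
namespace NambaTrees

noncomputable section

/-- The ordinal ω₂ (the second uncountable cardinal, as an ordinal). -/
def omega2 : Ordinal := (Cardinal.aleph 2).ord

/-- The set of extensions of `t` in `T`. -/
def ext (T : Set (List Ordinal)) (t : List Ordinal) : Set (List Ordinal) :=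
  {s | s ∈ T ∧ t <+: s}

/-- A tree: a set of finite sequences of ordinals below ω₂ closed under initial segments. -/
def IsTree (T : Set (List Ordinal)) : Prop :=
  (∀ t ∈ T, ∀ x ∈ t, x < omega2) ∧ ∀ s t : List Ordinal, s <+: t → t ∈ T → s ∈ T

/-- A perfect tree: a nonempty tree in which every element has ℵ₂-many extensions. -/
def IsPerfect (T : Set (List Ordinal)) : Prop :=
  IsTree T ∧ T.Nonempty ∧ ∀ t ∈ T, Cardinal.aleph 2 ≤ Cardinal.mk ↥(ext T t)

/-- The derived trees `T^(α)`: `T^(0) = T`, `T^(α+1)` consists of the elements of `T^(α)`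
with ℵ₂-many extensions in `T^(α)`, and intersections are taken at limits. -/
def derived (T : Set (List Ordinal)) (α : Ordinal) : Set (List Ordinal) :=
  Ordinal.limitRecOn α T
    (fun _ ih => {t | t ∈ ih ∧ Cardinal.aleph 2 ≤ Cardinal.mk ↥(ext ih t)})
    (fun o _ ih => {t | ∀ γ, ∀ h : γ < o, t ∈ ih γ h})

/-- The rank `h_T(t)`: the least `α` with `t ∉ T^(α)` (when it exists). -/
def rank (T : Set (List Ordinal)) (t : List Ordinal) : Ordinal :=
  sInf {α | t ∉ derived T α}

end

end NambaTrees

namespace NambaTrees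

universe u v

variable {T : Set (List Ordinal.{u})}

theorem ext_mono {S S' : Set (List Ordinal.{u})} {s t : List Ordinal.{u}} (hS : S ⊆ S')
    (hst : s <+: t) : ext S t ⊆ ext S' s :=
  fun _ hx => ⟨hS hx.1, hst.trans hx.2⟩

theorem derived_zero (T : Set (List Ordinal.{u})) : derived T (0 : Ordinal.{v}) = T :=
  Ordinal.limitRecOn_zero _ _ _

theorem derived_add_one (T : Set (List Ordinal.{u})) (α : Ordinal.{v}) :
    derived T (α + 1) =
      {t | t ∈ derived T α ∧ Cardinal.aleph 2 ≤ Cardinal.mk ↥(ext (derived T α) t)} :=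
  Ordinal.limitRecOn_add_one _ _ _ _

theorem mem_derived_limit {α : Ordinal.{v}} (hα : Order.IsSuccLimit α) {t : List Ordinal.{u}} :
    t ∈ derived T α ↔ ∀ γ < α, t ∈ derived T γ := by
  unfold derived
  rw [Ordinal.limitRecOn_limit _ _ _ _ hα]
  rfl

theorem derived_antitone (T : Set (List Ordinal.{u})) :
    Antitone (derived T : Ordinal.{v} → Set (List Ordinal.{u})) := by
  intro α β
  induction β using Ordinal.limitRecOn with
  | zero => intro h; rw [nonpos_iff_eq_zero.mp h]
  | add_one β ih =>
    intro h
    rcases Order.le_succ_iff_eq_or_le.mp h with rfl | h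
    · rfl
    · rw [derived_add_one]
      exact fun t ht => ih h ht.1
  | limit β hβ _ =>
    intro h
    rcases h.eq_or_lt with rfl | h
    · rfl
    · exact fun t ht => (mem_derived_limit hβ).mp ht α h

theorem derived_subset (T : Set (List Ordinal.{u})) (α : Ordinal.{v}) : derived T α ⊆ T := by
  simpa only [derived_zero] using derived_antitone T (zero_le (a := α))

theorem IsTree.derived (hT : IsTree T) (α : Ordinal.{v}) : IsTree (derived T α) := by
  refine ⟨fun t ht => hT.1 t (derived_subset T α ht), ?_⟩
  induction α using Ordinal.limitRecOn with
  | zero => rw [derived_zero]; exact hT.2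
  | add_one α ih =>
    rw [derived_add_one]
    exact fun s t hst ht =>
      ⟨ih s t hst ht.1, ht.2.trans (Cardinal.mk_le_mk_of_subset (ext_mono subset_rfl hst))⟩
  | limit α hα ih =>
    intro s t hst ht
    rw [mem_derived_limit hα] at ht ⊢
    exact fun γ hγ => ih γ hγ s t hst (ht γ hγ)

/-- A tree of sequences below ω₂ is small with respect to every universe. -/
theorem IsTree.small (hT : IsTree T) : Small.{v} T := by
  have : Small.{v} (Set.Iio omega2.{u}) := by
    rw [Cardinal.small_iff_lift_mk_lt_univ, Cardinal.mk_Iio_ordinal, omega2, Cardinal.card_ord]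
    simpa using Cardinal.lift_lt_univ' (Cardinal.aleph.{v} 2)
  have : Small.{v} (List (Set.Iio omega2.{u})) := inferInstance
  refine small_of_injective (β := List (Set.Iio omega2.{u}))
    (f := fun t : T => t.1.attach.map fun x => ⟨x.1, hT.1 t.1 t.2 x.1 x.2⟩) fun s t h => ?_
  have h' := congrArg (List.map Subtype.val) h
  simpa [Function.comp_def, Subtype.val_inj] using h'

theorem IsTree.exists_derived_eq_add_one (hT : IsTree T) :
    ∃ α : Ordinal.{v}, NambaTrees.derived T α = NambaTrees.derived T (α + 1) := by
  by_contra! hne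
  have hex (α : Ordinal.{v}) :
      ∃ t ∈ NambaTrees.derived T α, t ∉ NambaTrees.derived T (α + 1) :=
    Set.not_subset.mp fun h =>
      hne α (h.antisymm (derived_antitone T (le_add_of_nonneg_right zero_le)))
  choose f hf hf' using hex
  have : Small.{v} T := hT.small
  refine not_injective_of_ordinal
    (fun α : Ordinal.{v} => (⟨f α, derived_subset T α (hf α)⟩ : T)) fun α β h => ?_
  have hle {α β : Ordinal.{v}} (h : f α = f β) : β ≤ α := by
    by_contra! hlt
    exact hf' α (derived_antitone T (Order.add_one_le_of_lt hlt) (h ▸ hf β))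
  have h : f α = f β := congrArg Subtype.val h
  exact (hle h.symm).antisymm (hle h)

theorem IsTree.exists_derived_eq_empty (hT : IsTree T)
    (hnp : ¬ ∃ P : Set (List Ordinal.{u}), IsPerfect P ∧ P ⊆ T) :
    ∃ α : Ordinal.{v}, NambaTrees.derived T α = ∅ := by
  obtain ⟨α, hα⟩ := hT.exists_derived_eq_add_one
  refine ⟨α, Set.not_nonempty_iff_eq_empty.mp fun hne =>
    hnp ⟨_, ⟨hT.derived α, hne, fun t ht => ?_⟩, derived_subset T α⟩⟩
  rw [hα, derived_add_one] at ht
  exact ht.2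

/-- If it exists, the rank of an element of `T` is a successor ordinal. -/
theorem exists_rank_eq_add_one {t : List Ordinal.{u}} (ht : t ∈ T)
    (h : ∃ α : Ordinal.{v}, t ∉ derived T α) :
    ∃ α : Ordinal.{v}, rank T t = α + 1 := by
  have hmem : t ∉ derived T (rank T t : Ordinal.{v}) := csInf_mem h
  have hlt (γ : Ordinal.{v}) (hγ : γ < rank T t) : t ∈ derived T γ := by
    simpa using notMem_of_lt_csInf hγ (OrderBot.bddBelow _)
  rcases Ordinal.zero_or_succ_or_isSuccLimit (rank T t : Ordinal.{v}) with h0 | ⟨α, hα⟩ | hl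
  · rw [h0, derived_zero] at hmem
    exact absurd ht hmem
  · exact ⟨α, hα.symm⟩
  · exact absurd ((mem_derived_limit hl).mpr hlt) hmem

end NambaTrees

open NambaTrees in
/-- If a tree `T` contains no perfect subtree, then for every `t ∈ T` the set of extensions
of `t` in `T` of the same rank has cardinality at most ℵ₁. -/
theorem card_same_rank_extensions_le_aleph_one (T : Set (List Ordinal)) (hT : IsTree T)
    (hnp : ¬ ∃ P : Set (List Ordinal), IsPerfect P ∧ P ⊆ T) :
    ∀ t ∈ T, Cardinal.mk ↥{s : List Ordinal | s ∈ T ∧ t <+: s ∧ rank T s = rank T t} ≤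
      Cardinal.aleph 1 := by
  intro t ht
  obtain ⟨γ, hγ⟩ := hT.exists_derived_eq_empty hnp
  have hne : ∃ α, t ∉ derived T α := ⟨γ, by simp [hγ]⟩
  obtain ⟨α, hα⟩ := exists_rank_eq_add_one ht hne
  have mem_of_rank {s : List Ordinal} (hs : rank T s = α + 1) : s ∈ derived T α := by
    have : α < rank T s := hs ▸ lt_add_one α
    simpa using notMem_of_lt_csInf this (OrderBot.bddBelow _)
  have hmem : t ∉ derived T (rank T t) := csInf_mem hne
  rw [hα, derived_add_one] at hmem
  have hlt : Cardinal.mk ↥(ext (derived T α) t) < Cardinal.aleph 2 :=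
    not_le.mp fun h => hmem ⟨mem_of_rank hα, h⟩
  have h2 : Cardinal.aleph 2 = Order.succ (Cardinal.aleph 1) := by
    rw [Cardinal.succ_aleph, one_add_one_eq_two]
  rw [h2, Order.lt_succ_iff] at hlt
  refine (Cardinal.mk_le_mk_of_subset ?_).trans hlt
  exact fun s hs => ⟨mem_of_rank (hs.2.2.trans hα), hs.2.1⟩
end

section
/- Let K be a nonempty countable set and let ⟨E_k : k ∈ K⟩ be open subsets of Namba forcing whose union ⋃_{k∈K} E_k is dense in Namba forcing. Let T be a perfect tree and t ∈ T. Then there exist pairwise incompatible finite sequences ⟨t_β : β < ω₂⟩, all belonging to T and extending t, perfect trees ⟨T_β : β < ω₂⟩, and colors ⟨α_β : β < ω₂⟩ in K such that for every β < ω₂: T_β ⊆ T, every element of T_β is comparable with t_β, and T_β ∈ E_{α_β}. -/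
namespace NambaTrees

/-- An open subset of Namba forcing (the partial order of perfect trees under inclusion,
stronger conditions being smaller sets). -/
def NambaOpen (E : Set (Set (List Ordinal))) : Prop :=
  (∀ p ∈ E, IsPerfect p) ∧ ∀ p ∈ E, ∀ q : Set (List Ordinal), IsPerfect q → q ⊆ p → q ∈ E

/-- A dense subset of Namba forcing. -/
def NambaDense (E : Set (Set (List Ordinal))) : Prop :=
  ∀ p : Set (List Ordinal), IsPerfect p → ∃ q : Set (List Ordinal), IsPerfect q ∧ q ⊆ p ∧ q ∈ E

end NambaTrees

namespace NambaTrees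

/-- The subtree of elements of `T` comparable with `s` is perfect. -/
theorem IsPerfect.comparable {T : Set (List Ordinal)} (hT : IsPerfect T) {s : List Ordinal}
    (hs : s ∈ T) : IsPerfect {x | x ∈ T ∧ (x <+: s ∨ s <+: x)} := by
  obtain ⟨⟨hlt, hclosed⟩, -, hcard⟩ := hT
  refine ⟨⟨fun x hx => hlt x hx.1, ?_⟩, ⟨s, hs, Or.inl (List.prefix_refl s)⟩, ?_⟩
  · rintro x y hxy ⟨hy, hys | hsy⟩
    · exact ⟨hclosed x y hxy hy, Or.inl (hxy.trans hys)⟩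
    · exact ⟨hclosed x y hxy hy, List.prefix_or_prefix_of_prefix hxy hsy⟩
  · rintro x ⟨hx, hxs | hsx⟩
    · exact (hcard s hs).trans <| Cardinal.mk_le_mk_of_subset
        fun y hy => ⟨⟨hy.1, Or.inr hy.2⟩, hxs.trans hy.2⟩
    · exact (hcard x hx).trans <| Cardinal.mk_le_mk_of_subset
        fun y hy => ⟨⟨hy.1, Or.inr (hsx.trans hy.2)⟩, hy.2⟩

/-- Some level of a perfect tree contains `ℵ₂`-many extensions of a given element. -/
theorem IsPerfect.exists_level {T : Set (List Ordinal)} (hT : IsPerfect T) {t : List Ordinal}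
    (ht : t ∈ T) :
    ∃ n : ℕ, Cardinal.aleph 2 ≤ Cardinal.mk ↥{s | s ∈ ext T t ∧ s.length = n} := by
  have hreg : (Cardinal.aleph 2).IsRegular := by
    simpa only [one_add_one_eq_two] using Cardinal.isRegular_aleph_add_one 1
  obtain ⟨⟨n⟩, hn⟩ := Cardinal.infinite_pigeonhole_card
    (fun s : ext T t => ULift.up s.1.length) (Cardinal.aleph 2) (hT.2.2 t ht)
    (Cardinal.aleph0_le_aleph 2) (by
      rw [hreg.cof_ord, Cardinal.mk_uLift, Cardinal.mk_nat, Cardinal.lift_aleph0,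
        ← Cardinal.aleph_zero]
      exact Cardinal.aleph_lt_aleph.2 two_pos)
  refine ⟨n, hn.trans <| Cardinal.mk_le_of_injective
    (f := fun s => ⟨s.1.1, s.1.2, congrArg ULift.down s.2⟩) ?_⟩
  intro a b hab
  exact Subtype.ext (Subtype.ext (Subtype.mk.inj hab))

/-- A set of size at least `ℵ₂` contains an injective sequence of length `ω₂`. -/
theorem exists_injOn_omega2.{u, v} {α : Type u} {A : Set α} (hA : Cardinal.aleph 2 ≤ Cardinal.mk A) :
    ∃ f : Ordinal.{v} → α, (∀ β < omega2, f β ∈ A) ∧ Set.InjOn f (Set.Iio omega2) := by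
  have hcard : Cardinal.lift.{u} (Cardinal.mk (Set.Iio omega2.{v})) ≤
      Cardinal.lift.{v + 1} (Cardinal.mk A) := by
    rw [Cardinal.mk_Iio_ordinal, omega2, Cardinal.card_ord]
    simpa using hA
  obtain ⟨g⟩ := Cardinal.lift_mk_le'.1 hcard
  have : Nonempty α := ⟨(g ⟨0, Cardinal.ord_pos.2 (Cardinal.aleph_pos 2)⟩).1⟩
  classical
  refine ⟨fun β => if h : β < omega2 then (g ⟨β, h⟩).1 else Classical.arbitrary α, ?_, ?_⟩
  · intro β hβ
    simp [hβ]
  · intro β hβ γ hγ h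
    rw [Set.mem_Iio] at hβ hγ
    simp only [hβ, hγ, dif_pos, Subtype.val_inj] at h
    exact Subtype.mk.inj (g.injective h)

end NambaTrees

open NambaTrees in
/-- If `⟨E_k : k ∈ K⟩` (K countable nonempty) are open subsets of Namba forcing whose union
is dense, `T` is a perfect tree and `t ∈ T`, then there are pairwise incompatible sequences
`⟨t_β : β < ω₂⟩` in `T` extending `t`, perfect trees `⟨T_β : β < ω₂⟩` and colors
`⟨α_β : β < ω₂⟩` in `K` such that for each `β < ω₂`: `T_β ⊆ T`, every element of `T_β` is
comparable with `t_β`, and `T_β ∈ E_{α_β}`. -/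
theorem namba_fan_into_open_cover {K : Type} [Countable K] [Nonempty K]
    (E : K → Set (Set (List Ordinal)))
    (hopen : ∀ k : K, NambaOpen (E k))
    (hdense : NambaDense (⋃ k : K, E k))
    (T : Set (List Ordinal)) (hT : IsPerfect T) (t : List Ordinal) (ht : t ∈ T) :
    ∃ (ts : Ordinal → List Ordinal) (Ts : Ordinal → Set (List Ordinal)) (as : Ordinal → K),
      (∀ β γ : Ordinal, β < omega2 → γ < omega2 → β ≠ γ →
        ¬ (ts β <+: ts γ ∨ ts γ <+: ts β)) ∧
      ∀ β : Ordinal, β < omega2 →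
        ts β ∈ T ∧ t <+: ts β ∧ IsPerfect (Ts β) ∧ Ts β ⊆ T ∧
        (∀ x ∈ Ts β, x <+: ts β ∨ ts β <+: x) ∧ Ts β ∈ E (as β) := by
  obtain ⟨n, hn⟩ := hT.exists_level ht
  obtain ⟨ts, hts, hinj⟩ := exists_injOn_omega2 hn
  have hcone : ∀ β : Ordinal, ∃ (q : Set (List Ordinal)) (k : K), β < omega2 →
      IsPerfect q ∧ q ⊆ {x | x ∈ T ∧ (x <+: ts β ∨ ts β <+: x)} ∧ q ∈ E k := by
    intro β
    by_cases hβ : β < omega2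
    · obtain ⟨q, hq, hsub, hqE⟩ := hdense _ (hT.comparable (hts β hβ).1.1)
      obtain ⟨k, hk⟩ := Set.mem_iUnion.1 hqE
      exact ⟨q, k, fun _ => ⟨hq, hsub, hk⟩⟩
    · exact ⟨∅, Classical.arbitrary K, fun h => absurd h hβ⟩
  choose Ts as hTs using hcone
  refine ⟨ts, Ts, as, ?_, fun β hβ => ?_⟩
  · intro β γ hβ hγ hne hcomp
    have hlen : (ts β).length = (ts γ).length := (hts β hβ).2.trans (hts γ hγ).2.symm
    refine hne (hinj hβ hγ ?_)
    rcases hcomp with h | h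
    · exact h.eq_of_length hlen
    · exact (h.eq_of_length hlen.symm).symm
  · obtain ⟨hperf, hsub, hE⟩ := hTs β hβ
    exact ⟨(hts β hβ).1.1, (hts β hβ).1.2, hperf, fun x hx => (hsub hx).1,
      fun x hx => (hsub hx).2, hE⟩
end

section
/- Assume CH. Let K be a nonempty countable set. Suppose T_⟨⟩ is a perfect tree and for every n ≥ 1 and every s ∈ ⁿω₂ (finite sequence of ordinals below ω₂ of length n) we are given a perfect tree T_s, a finite sequence t_s, and a color α_s ∈ K such that: (i) every element of T_s is comparable with t_s; (ii) for each n, the sequences t_s for s ∈ ⁿω₂ are pairwise incompatible; and (iii) T_s ⊆ T_{s′} whenever s′ is an initial segment of s. For g : ω → K and n ∈ ω set 𝒯_n(g) = ⋃{T_s : s ∈ ⁿω₂ and α_{s↾i} = g(i−1) for every i with 1 ≤ i ≤ n}. Then there exists g : ω → K such that ⋂_{n∈ω} 𝒯_n(g) contains a perfect subtree. -/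
namespace NambaTrees

open Cardinal

universe u

section Game

variable {ι : Type u} {K : Type}

/-- Player II loses with rank at most `α`, from the position `s`, the game in which player I
plays sets of size at most `ℵ₁` and player II answers outside of them, obeying the
colors prescribed by `g`. -/
def Losing (c : List ι → K) (g : ℕ → K) (α : Ordinal.{u}) (s : List ι) : Prop :=
  ∃ A : Set ι, #A ≤ ℵ₁ ∧ ∀ a ∉ A, c (s ++ [a]) = g s.length →
    ∃ β, ∃ _ : β < α, Losing c g β (s ++ [a])
termination_by α

theorem exists_uniform_answer (c : List ι → K) (g : ℕ → K) (s : List ι) :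
    ∃ A : Set ι, #A ≤ ℵ₁ ∧ ∀ α : Ordinal.{u}, Losing c g α s → ∀ a ∉ A,
      c (s ++ [a]) = g s.length → ∃ β < α, Losing c g β (s ++ [a]) := by
  by_cases h : ∃ α : Ordinal.{u}, Losing c g α s
  · obtain ⟨α, hα, hmin⟩ := WellFounded.has_min Ordinal.lt_wf {α | Losing c g α s} h
    have hα' : Losing c g α s := hα
    rw [Losing] at hα'
    obtain ⟨A, hA, hA'⟩ := hα'
    refine ⟨A, hA, fun γ hγ a ha hc => ?_⟩
    obtain ⟨β, hβ, hl⟩ := hA' a ha hc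
    exact ⟨β, hβ.trans_le (not_lt.1 (hmin γ hγ)), hl⟩
  · exact ⟨∅, by simp, fun α hα => (h ⟨α, hα⟩).elim⟩

theorem exists_not_losing_append (c : List ι → K) (g : ℕ → K) (s : List ι)
    (hs : ∀ α : Ordinal.{u}, ¬ Losing c g α s) (A : Set ι) (hA : #A ≤ ℵ₁) :
    ∃ a ∉ A, c (s ++ [a]) = g s.length ∧ ∀ α : Ordinal.{u}, ¬ Losing c g α (s ++ [a]) := by
  by_contra! h
  have h' : ∀ a, ∃ α : Ordinal.{u}, a ∉ A → c (s ++ [a]) = g s.length →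
      Losing c g α (s ++ [a]) := by
    intro a
    by_cases ha : a ∉ A ∧ c (s ++ [a]) = g s.length
    · obtain ⟨α, hα⟩ := h a ha.1 ha.2
      exact ⟨α, fun _ _ => hα⟩
    · exact ⟨0, fun h₁ h₂ => (ha ⟨h₁, h₂⟩).elim⟩
  choose f hf using h'
  apply hs (Order.succ (⨆ a, f a))
  rw [Losing]
  exact ⟨A, hA, fun a ha hc => ⟨f a, Order.lt_succ_of_le (Ordinal.le_iSup f a), hf a ha hc⟩⟩

theorem exists_forall_not_losing (hι : ℵ₁ < #ι) (hK : #(ℕ → K) ≤ ℵ₁) (c : List ι → K) :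
    ∃ g : ℕ → K, ∀ α : Ordinal.{u}, ¬ Losing c g α [] := by
  by_contra! hlose
  choose A hA hA' using exists_uniform_answer c
  have hpick : ∀ s, ∃ a, ∀ g, a ∉ A g s := by
    intro s
    by_contra! h
    have hU : (⋃ g, A g s) = Set.univ := Set.eq_univ_of_forall fun a => Set.mem_iUnion.2 (h a)
    have hle : lift.{0} #(⋃ g, A g s) ≤ lift #(ℕ → K) * ⨆ g, lift.{0} #(A g s) :=
      mk_iUnion_le_lift _
    rw [hU, mk_univ] at hle
    simp only [lift_uzero] at hle
    have hsup : (⨆ g, #(A g s)) ≤ ℵ₁ := ciSup_le' fun g => hA g s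
    have hK' : lift #(ℕ → K) ≤ ℵ₁ := by simpa using lift_le.2 hK
    refine (hle.trans (mul_le_mul' hK' hsup)).not_gt ?_
    rwa [mul_eq_self (aleph0_le_aleph 1)]
  choose pick hpick using hpick
  let b : ℕ → List ι := fun n => Nat.rec [] (fun _ s => s ++ [pick s]) n
  have hb : ∀ n, b (n + 1) = b n ++ [pick (b n)] := fun n => rfl
  have hlen : ∀ n, (b n).length = n := by
    intro n
    induction n with
    | zero => rfl
    | succ n ih => simp [hb, ih]
  let g : ℕ → K := fun n => c (b (n + 1))
  have hfalse : ∀ α : Ordinal.{u}, ∀ n, ¬ Losing c g α (b n) := by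
    intro α
    induction α using WellFoundedLT.induction with
    | ind α ih =>
      intro n hn
      obtain ⟨β, hβ, hl⟩ := hA' g (b n) α hn (pick (b n)) (hpick (b n) g) (by
        simp only [g, hlen, hb])
      exact ih β hβ (n + 1) hl
  obtain ⟨α, hα⟩ := hlose g
  exact hfalse α 0 hα

/-- A coloring of the finite sequences from a set of size greater than `ℵ₁` is constant on each
level of some nonempty tree all of whose nodes have more than `ℵ₁` immediate successors. -/
theorem exists_level_homogeneous (hι : ℵ₁ < #ι) (hK : #(ℕ → K) ≤ ℵ₁) (c : List ι → K) :
    ∃ g : ℕ → K, ∃ S : Set (List ι), [] ∈ S ∧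
      (∀ s ∈ S, ∀ i, 1 ≤ i → i ≤ s.length → c (s.take i) = g (i - 1)) ∧
      ∀ s ∈ S, ℵ₁ < #{a | s ++ [a] ∈ S} := by
  obtain ⟨g, hg⟩ := exists_forall_not_losing hι hK c
  refine ⟨g, {s | (∀ i, 1 ≤ i → i ≤ s.length → c (s.take i) = g (i - 1)) ∧
    ∀ α : Ordinal.{u}, ¬ Losing c g α s}, ⟨?_, hg⟩, fun s hs => hs.1, ?_⟩
  · intro i h₁ h₂
    simp at h₂
    omega
  · intro s hs
    by_contra! h
    obtain ⟨a, ha, hc, hl⟩ := exists_not_losing_append c g s hs.2 _ h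
    refine ha ⟨fun i h₁ h₂ => ?_, hl⟩
    rw [List.length_append, List.length_singleton] at h₂
    rcases h₂.lt_or_eq with h₃ | rfl
    · rw [List.take_append_of_le_length (by omega)]
      exact hs.1 i h₁ (by omega)
    · rw [List.take_of_length_le (by simp)]
      simpa using hc

end Game

theorem IsPerfect.stem_mem {T : Set (List Ordinal)} (hT : IsPerfect T) {t : List Ordinal}
    (ht : ∀ x ∈ T, x <+: t ∨ t <+: x) : t ∈ T := by
  obtain ⟨⟨-, hcl⟩, ⟨y, hy⟩, hext⟩ := hT
  by_contra hn
  have hsub : ext T y ⊆ {x | x ∈ t.inits} := fun x hx =>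
    (List.mem_inits _ _).2 ((ht x hx.1).resolve_right fun h => hn (hcl _ _ h hx.1))
  have hfin : (ext T y).Finite := (List.finite_toSet _).subset hsub
  exact ((hext y hy).trans_lt (Set.Finite.lt_aleph0 hfin)).not_ge (aleph0_le_aleph 2)

/-- The perfect subtree obtained from the stems of a fusion system along a tree of indices with
large splitting. -/
theorem isPerfect_stem_closure {ι : Type*} {T : List ι → Set (List Ordinal)}
    {t : List ι → List Ordinal} (hT : ∀ s, IsPerfect (T s)) (hmem : ∀ s, t s ∈ T s)
    {S : Set (List ι)} (hS : S.Nonempty)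
    (hsplit : ∀ s ∈ S, ℵ₁ < #{a | s ++ [a] ∈ S ∧ t s <+: t (s ++ [a])})
    (hinj : ∀ s, Function.Injective fun a => t (s ++ [a])) :
    IsPerfect {x | ∃ s ∈ S, x <+: t s} := by
  refine ⟨⟨?_, ?_⟩, ?_, ?_⟩
  · rintro x ⟨s, -, hx⟩ y hy
    exact (hT s).1.1 _ (hmem s) y (hx.subset hy)
  · rintro x y hxy ⟨s, hs, hy⟩
    exact ⟨s, hs, hxy.trans hy⟩
  · obtain ⟨s, hs⟩ := hS
    exact ⟨t s, s, hs, List.prefix_rfl⟩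
  · rintro x ⟨s, hs, hx⟩
    let E := {a | s ++ [a] ∈ S ∧ t s <+: t (s ++ [a])}
    have h₂ : ℵ_ 2 ≤ #E := by
      rw [← one_add_one_eq_two, ← succ_aleph]
      exact Order.succ_le_of_lt (hsplit s hs)
    let f : E → ext {x | ∃ s ∈ S, x <+: t s} x := fun a =>
      ⟨t (s ++ [a.1]), ⟨s ++ [a.1], a.2.1, List.prefix_rfl⟩, hx.trans a.2.2⟩
    have hf : Function.Injective f := fun a b hab =>
      Subtype.ext (hinj s (congrArg Subtype.val hab))
    simpa using (lift_le.2 h₂).trans (lift_mk_le_lift_mk_of_injective hf)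

theorem mk_nat_arrow_le_aleph_one {K : Type} [Countable K]
    (ch : (2 : Cardinal) ^ Cardinal.aleph 0 = Cardinal.aleph 1) : #(ℕ → K) ≤ ℵ₁ := by
  have h : (𝔠 : Cardinal.{0}) = ℵ₁ := by
    have h' := ch
    rw [aleph_zero, two_power_aleph0] at h'
    apply lift_injective
    simpa using h'
  rw [← power_def, mk_nat, ← h, ← aleph0_power_aleph0]
  exact power_le_power_right mk_le_aleph0

/-- A fusion system all of whose trees, the first one included, are equipped with a stem. -/
theorem exists_perfect_of_fusion {ι : Type*} {K : Type} (hι : ℵ₁ < #ι) (hK : #(ℕ → K) ≤ ℵ₁)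
    (T : List ι → Set (List Ordinal)) (t : List ι → List Ordinal) (c : List ι → K)
    (hT : ∀ s, IsPerfect (T s)) (hstem : ∀ s, ∀ x ∈ T s, x <+: t s ∨ t s <+: x)
    (hincomp : ∀ s s', s.length = s'.length → s ≠ s' → ¬ (t s <+: t s' ∨ t s' <+: t s))
    (hmono : ∀ s s', s' <+: s → T s ⊆ T s') :
    ∃ g : ℕ → K, ∃ P : Set (List Ordinal), IsPerfect P ∧ ∀ x ∈ P, ∀ n, ∃ s : List ι,
      s.length = n ∧ (∀ i, 1 ≤ i → i ≤ n → c (s.take i) = g (i - 1)) ∧ x ∈ T s := by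
  obtain ⟨g, S, hnil, hcol, hsplit⟩ := exists_level_homogeneous hι hK c
  have hmem : ∀ s, t s ∈ T s := fun s => (hT s).stem_mem (hstem s)
  have hne : ∀ s a b, a ≠ b → ¬ (t (s ++ [a]) <+: t (s ++ [b]) ∨ t (s ++ [b]) <+: t (s ++ [a])) :=
    fun s a b hab => hincomp _ _ (by simp) (by simpa using hab)
  have hsplit' : ∀ s ∈ S, ℵ₁ < #{a | s ++ [a] ∈ S ∧ t s <+: t (s ++ [a])} := by
    intro s hs
    by_contra! h
    have hsub : {a | ¬ t s <+: t (s ++ [a])}.Subsingleton := by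
      intro a ha b hb
      have key : ∀ a, ¬ t s <+: t (s ++ [a]) → t (s ++ [a]) <+: t s := fun a ha =>
        (hstem s _ (hmono _ s (List.prefix_append _ _) (hmem (s ++ [a])))).resolve_right ha
      by_contra hab
      exact hne s a b hab (List.prefix_or_prefix_of_prefix (key a ha) (key b hb))
    have hle : #{a | s ++ [a] ∈ S} ≤ ℵ₁ := by
      refine (mk_le_mk_of_subset (t := {a | s ++ [a] ∈ S ∧ t s <+: t (s ++ [a])} ∪
        {a | ¬ t s <+: t (s ++ [a])}) fun a ha => ?_).trans ((mk_union_le _ _).trans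
        (add_le_of_le (aleph0_le_aleph 1) h ?_))
      · by_cases hp : t s <+: t (s ++ [a])
        · exact Or.inl ⟨ha, hp⟩
        · exact Or.inr hp
      · exact (mk_le_one_iff_set_subsingleton.2 hsub).trans
          (one_le_aleph0.trans (aleph0_le_aleph 1))
    exact hle.not_gt (hsplit s hs)
  refine ⟨g, _, isPerfect_stem_closure hT hmem ⟨[], hnil⟩ hsplit' fun s a b hab => ?_, ?_⟩
  · by_contra hne'
    exact hne s a b hne' (Or.inl (by rw [show t (s ++ [a]) = t (s ++ [b]) from hab]))
  · rintro x ⟨s, hs, hx⟩ n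
    have hlong : ∀ n, ∃ s' ∈ S, n ≤ s'.length ∧ t s <+: t s' := by
      intro n
      induction n with
      | zero => exact ⟨s, hs, Nat.zero_le _, List.prefix_rfl⟩
      | succ n ih =>
        obtain ⟨s', hs', hn, hp⟩ := ih
        obtain ⟨a, ha⟩ := mk_ne_zero_iff.1 (bot_lt_of_lt (hsplit' s' hs')).ne'
        exact ⟨s' ++ [a], ha.1, by simpa using hn, hp.trans ha.2⟩
    obtain ⟨s', hs', hn, hp⟩ := hlong n
    refine ⟨s'.take n, by simpa using hn, fun i h₁ h₂ => ?_,
      hmono s' _ (List.take_prefix _ _) ((hT s').1.2 _ _ (hx.trans hp) (hmem s'))⟩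
    rw [List.take_take, min_eq_left h₂]
    exact hcol s' hs' i h₁ (h₂.trans hn)

end NambaTrees

open NambaTrees in
/-- Assume CH. Given a fusion system: perfect trees `T_s`, stems `t_s` and colors `α_s ∈ K`
(`K` countable nonempty), indexed by finite sequences `s` of ordinals below ω₂, such that
(i) every element of `T_s` is comparable with `t_s` (for `s ≠ ⟨⟩`), (ii) for each `n` the
stems `t_s`, `s ∈ ⁿω₂`, are pairwise incompatible, and (iii) `T_s ⊆ T_{s'}` whenever `s'`
is an initial segment of `s`; then there is `g : ω → K` such that
`⋂_n 𝒯_n(g)` contains a perfect subtree, where `𝒯_n(g) = ⋃ {T_s : s ∈ ⁿω₂ and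
α_{s↾i} = g(i-1) for all 1 ≤ i ≤ n}`. -/
theorem namba_fusion_of_CH (ch : (2 : Cardinal) ^ Cardinal.aleph 0 = Cardinal.aleph 1)
    {K : Type} [Countable K] [Nonempty K]
    (Ts : List Ordinal → Set (List Ordinal))
    (ts : List Ordinal → List Ordinal)
    (as : List Ordinal → K)
    (hperf : ∀ s : List Ordinal, (∀ x ∈ s, x < omega2) → IsPerfect (Ts s))
    (hstem : ∀ s : List Ordinal, s ≠ [] → (∀ x ∈ s, x < omega2) →
      ∀ x ∈ Ts s, x <+: ts s ∨ ts s <+: x)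
    (hincomp : ∀ s s' : List Ordinal, (∀ x ∈ s, x < omega2) → (∀ x ∈ s', x < omega2) →
      s.length = s'.length → s ≠ [] → s ≠ s' → ¬ (ts s <+: ts s' ∨ ts s' <+: ts s))
    (hmono : ∀ s s' : List Ordinal, (∀ x ∈ s, x < omega2) → s' <+: s → Ts s ⊆ Ts s') :
    ∃ g : ℕ → K, ∃ P : Set (List Ordinal), IsPerfect P ∧
      P ⊆ ⋂ n : ℕ, ⋃ s ∈ {s : List Ordinal | s.length = n ∧ (∀ x ∈ s, x < omega2) ∧
        ∀ i : ℕ, 1 ≤ i → i ≤ n → as (s.take i) = g (i - 1)}, Ts s := by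
  let v : List (Set.Iio omega2) → List Ordinal := List.map Subtype.val
  have hv : ∀ s, ∀ x ∈ v s, x < omega2 := by
    intro s x hx
    obtain ⟨y, -, rfl⟩ := List.mem_map.1 hx
    exact y.2
  have hv_nil : ∀ s, s ≠ [] → v s ≠ [] := fun s hs h => hs (List.map_eq_nil_iff.1 h)
  have hv_inj : Function.Injective v := List.map_injective_iff.2 Subtype.val_injective
  have hι : Cardinal.aleph 1 < Cardinal.mk (Set.Iio omega2) := by
    rw [Cardinal.mk_Iio_ordinal, omega2, Cardinal.card_ord, Cardinal.lift_aleph]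
    simp
  obtain ⟨g, P, hP, hsub⟩ := exists_perfect_of_fusion hι (mk_nat_arrow_le_aleph_one ch)
    (fun s => Ts (v s)) (fun s => if s = [] then [] else ts (v s)) (fun s => as (v s))
    (fun s => hperf _ (hv s))
    (fun s x hx => by
      by_cases hs : s = []
      · simp [hs]
      · simpa only [hs, if_false] using hstem _ (hv_nil s hs) (hv s) x hx)
    (fun s s' hlen hne => by
      have hs : s ≠ [] := by
        rintro rfl
        exact hne (List.length_eq_zero_iff.1 hlen.symm).symm
      have hs' : s' ≠ [] := by
        rintro rfl
        exact hs (List.length_eq_zero_iff.1 hlen)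
      simpa only [hs, hs', if_false] using hincomp _ _ (hv s) (hv s') (by simpa [v] using hlen)
        (hv_nil s hs) (hv_inj.ne hne))
    (fun s s' h => hmono _ _ (hv s) (h.map _))
  refine ⟨g, P, hP, fun x hx => Set.mem_iInter.2 fun n => ?_⟩
  obtain ⟨s, hlen, hcol, hxs⟩ := hsub x hx n
  refine Set.mem_biUnion (x := v s) ⟨by simpa [v] using hlen, hv s, fun i h₁ h₂ => ?_⟩ hxs
  simpa [v, List.map_take] using hcol i h₁ h₂
end
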